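/- Fix θ > 0. For every ε > 0, lim_{H → (1/2)⁺} sup_{t ∈ [ε,+∞)} e^{t/θ} |V'_{2,H}(t) − e^{-2t/θ}| = 0, where V'_{2,H}(t) = 2H(2H-1) e^{-2t/θ} ∫_0^t e^{z/θ} z^{2H-2} dz. Equivalently, for every ε > 0 there exist H_ε ∈ (1/2,1) and a function C_ε : (1/2,H_ε] → ℝ₊ with C_ε(H) → 0 as H → (1/2)⁺ such that |V'_{2,H}(t) − e^{-2t/θ}| ≤ C_ε(H) e^{-t/θ} for all t ≥ ε and all H ∈ (1/2,H_ε]. -/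

import Mathlib

open Real Filter Set

/-- The derivative of the variance of the fractional Ornstein–Uhlenbeck process for
`H ∈ (1/2,1)`: `V'_{2,H}(t) = 2H(2H-1) e^{-2t/θ} ∫_0^t e^{z/θ} z^{2H-2} dz`. -/
noncomputable def V2' (θ H t : ℝ) : ℝ :=
  2 * H * (2 * H - 1) * Real.exp (-(2 * t) / θ) *
    ∫ z in (0:ℝ)..t, Real.exp (z / θ) * z ^ (2 * H - 2)

lemma aux_int (θ : ℝ) (a x y : ℝ) (ha : 0 < a) :
    IntervalIntegrable (fun z => Real.exp (z / θ) * z ^ (a - 1)) MeasureTheory.volume x y := by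
  apply IntervalIntegrable.continuousOn_mul
  · exact intervalIntegral.intervalIntegrable_rpow' (by linarith)
  · exact (by fun_prop : Continuous fun z : ℝ => Real.exp (z / θ)).continuousOn

lemma aux_bound (θ : ℝ) (hθ : 0 < θ) (ε a t : ℝ) (hε : 0 < ε) (ha : 0 < a) (ha1 : a < 1)
    (ht : ε ≤ t) :
    ε ^ a ≤ a * (∫ z in (0:ℝ)..t, Real.exp (z / θ) * z ^ (a - 1)) ∧
    a * (∫ z in (0:ℝ)..t, Real.exp (z / θ) * z ^ (a - 1)) ≤
      ε ^ a + a * (Real.exp (ε / θ) / θ * ε ^ (a + 1) + ε ^ (a - 1) * θ * Real.exp (t / θ)) := by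
  have hsplit := intervalIntegral.integral_add_adjacent_intervals
    (aux_int θ a 0 ε ha) (aux_int θ a ε t ha)
  have hr : ∫ z in (0:ℝ)..ε, z ^ (a - 1) = ε ^ a / a := by
    rw [integral_rpow (Or.inl (by linarith))]
    simp [Real.zero_rpow ha.ne']
  have hr2 : ∫ z in (0:ℝ)..ε, z ^ a = ε ^ (a + 1) / (a + 1) := by
    rw [integral_rpow (Or.inl (by linarith))]
    simp [Real.zero_rpow (by linarith : a + 1 ≠ 0)]
  have i1 : IntervalIntegrable (fun z : ℝ => z ^ (a - 1)) MeasureTheory.volume 0 ε :=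
    intervalIntegral.intervalIntegrable_rpow' (by linarith)
  have i2 : IntervalIntegrable (fun z : ℝ => z ^ a) MeasureTheory.volume 0 ε :=
    intervalIntegral.intervalIntegrable_rpow' (by linarith)
  have l1 : ε ^ a / a ≤ ∫ z in (0:ℝ)..ε, Real.exp (z / θ) * z ^ (a - 1) := by
    rw [← hr]
    apply intervalIntegral.integral_mono_on hε.le i1 (aux_int θ a 0 ε ha)
    intro z hz
    have h1 : 1 ≤ Real.exp (z / θ) := Real.one_le_exp (div_nonneg hz.1 hθ.le)
    have h2 : 0 ≤ z ^ (a - 1) := Real.rpow_nonneg hz.1 _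
    nlinarith
  have l2 : 0 ≤ ∫ z in ε..t, Real.exp (z / θ) * z ^ (a - 1) := by
    apply intervalIntegral.integral_nonneg ht
    intro z hz
    have : 0 ≤ z := hε.le.trans hz.1
    positivity
  have u1 : ∫ z in (0:ℝ)..ε, Real.exp (z / θ) * z ^ (a - 1) ≤
      ε ^ a / a + Real.exp (ε / θ) / θ * (ε ^ (a + 1) / (a + 1)) := by
    rw [← hr, ← hr2, ← intervalIntegral.integral_const_mul,
      ← intervalIntegral.integral_add i1 (i2.const_mul _)]
    apply intervalIntegral.integral_mono_on_of_le_Ioo hε.le (aux_int θ a 0 ε ha)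
      (i1.add (i2.const_mul _))
    intro z hz
    have h2 : 0 ≤ z ^ (a - 1) := Real.rpow_nonneg hz.1.le _
    have h3 : z ^ a = z ^ (a - 1) * z := by
      rw [Real.rpow_sub_one hz.1.ne', div_mul_cancel₀ _ hz.1.ne']
    have h0 : 0 < z / θ := div_pos hz.1 hθ
    have h4 : Real.exp (z / θ) ≤ 1 + z / θ * Real.exp (z / θ) := by
      have := Real.add_one_le_exp (-(z / θ))
      have h5 : Real.exp (-(z / θ)) * Real.exp (z / θ) = 1 := by
        rw [← Real.exp_add]; simp
      nlinarith [Real.exp_pos (z / θ)]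
    have h6 : Real.exp (z / θ) ≤ Real.exp (ε / θ) := by
      apply Real.exp_le_exp.2
      exact div_le_div_of_nonneg_right hz.2.le hθ.le
    have h7 : Real.exp (z / θ) ≤ 1 + z / θ * Real.exp (ε / θ) := by nlinarith
    calc Real.exp (z / θ) * z ^ (a - 1) ≤ (1 + z / θ * Real.exp (ε / θ)) * z ^ (a - 1) := by
          gcongr
      _ = z ^ (a - 1) + Real.exp (ε / θ) / θ * z ^ a := by rw [h3]; ring
  have u2 : ∫ z in ε..t, Real.exp (z / θ) * z ^ (a - 1) ≤
      ε ^ (a - 1) * θ * Real.exp (t / θ) := by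
    have ci : IntervalIntegrable (fun z : ℝ => Real.exp (z / θ) * ε ^ (a - 1))
        MeasureTheory.volume ε t :=
      (by fun_prop : Continuous fun z : ℝ => Real.exp (z / θ) * ε ^ (a - 1)).intervalIntegrable _ _
    calc _ ≤ ∫ z in ε..t, Real.exp (z / θ) * ε ^ (a - 1) := by
          apply intervalIntegral.integral_mono_on ht (aux_int θ a ε t ha) ci
          intro z hz
          have := Real.rpow_le_rpow_of_nonpos hε hz.1 (by linarith : a - 1 ≤ 0)
          gcongr
      _ = θ * (Real.exp (t / θ) - Real.exp (ε / θ)) * ε ^ (a - 1) := by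
          rw [intervalIntegral.integral_mul_const,
            intervalIntegral.integral_comp_div (fun z => Real.exp z) hθ.ne', integral_exp]
          simp
      _ ≤ _ := by
          have := Real.exp_pos (ε / θ)
          have h2 : 0 < ε ^ (a - 1) := Real.rpow_pos_of_pos hε _
          have : 0 < θ * Real.exp (ε / θ) * ε ^ (a - 1) := by positivity
          nlinarith
  rw [← hsplit]
  have e : a * (ε ^ a / a) = ε ^ a := by field_simp
  constructor
  · calc ε ^ a = a * (ε ^ a / a) := e.symm
      _ ≤ _ := by gcongr; linarith
  · have h8 : ε ^ (a + 1) / (a + 1) ≤ ε ^ (a + 1) :=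
      div_le_self (Real.rpow_nonneg hε.le _) (by linarith)
    have h9 : Real.exp (ε / θ) / θ * (ε ^ (a + 1) / (a + 1)) ≤
        Real.exp (ε / θ) / θ * ε ^ (a + 1) := by gcongr
    rw [← e]
    nlinarith

/-- For every `ε > 0`, `e^{t/θ} (V'_{2,H}(t) - e^{-2t/θ}) → 0` uniformly on `[ε,∞)`
as `H → 1/2⁺` (note `V'_{2,1/2}(t) = e^{-2t/θ}`). -/
theorem V2'_weighted_uniform_convergence (θ : ℝ) (hθ : 0 < θ) :
    ∀ ε > (0:ℝ),
      TendstoUniformlyOn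
        (fun H t => Real.exp (t / θ) * (V2' θ H t - Real.exp (-(2 * t) / θ)))
        (fun _ => 0)
        (nhdsWithin (1/2 : ℝ) (Set.Ioi (1/2 : ℝ))) (Set.Ici ε) := by
  intro ε hε
  rw [Metric.tendstoUniformlyOn_iff]
  intro δ hδ
  let C : ℝ → ℝ := fun H => |2 * H * ε ^ (2 * H - 1) - 1| +
    2 * H * (2 * H - 1) * (Real.exp (ε / θ) / θ * ε ^ (2 * H - 1 + 1) + ε ^ (2 * H - 1 - 1) * θ)
  have hC : Continuous C := by
    have h : ∀ f : ℝ → ℝ, Continuous f → Continuous fun H => ε ^ f H := fun f hf =>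
      Continuous.rpow continuous_const hf (fun _ => Or.inl hε.ne')
    have h1 := h (fun H => 2 * H - 1) (by fun_prop)
    have h2 := h (fun H => 2 * H - 1 + 1) (by fun_prop)
    have h3 := h (fun H => 2 * H - 1 - 1) (by fun_prop)
    fun_prop
  have hC0 : C (1/2) = 0 := by simp [C]
  have hev : ∀ᶠ H in nhdsWithin (1/2 : ℝ) (Set.Ioi (1/2 : ℝ)), C H < δ := by
    have := hC.tendsto (1/2)
    rw [hC0] at this
    exact (this.mono_left nhdsWithin_le_nhds).eventually (gt_mem_nhds hδ)
  have hlt : ∀ᶠ H in nhdsWithin (1/2 : ℝ) (Set.Ioi (1/2 : ℝ)), H < 1 :=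
    nhdsWithin_le_nhds (gt_mem_nhds (by norm_num))
  filter_upwards [hev, hlt, self_mem_nhdsWithin] with H hH hH1 hH2 t ht
  have hH2' : 1 / 2 < H := hH2
  rw [dist_zero_left, Real.norm_eq_abs]
  refine lt_of_le_of_lt ?_ hH
  obtain ⟨lo, up⟩ := aux_bound θ hθ ε (2 * H - 1) t hε (by linarith) (by linarith) ht
  have he : Real.exp (t / θ) * Real.exp (-(2 * t) / θ) = Real.exp (-(t / θ)) := by
    rw [← Real.exp_add]; congr 1; ring
  have hee : Real.exp (-(t / θ)) * Real.exp (t / θ) = 1 := by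
    rw [← Real.exp_add]; simp
  have hpos : 0 < t / θ := div_pos (lt_of_lt_of_le hε ht) hθ
  have hle : Real.exp (-(t / θ)) ≤ 1 := Real.exp_le_one_iff.2 (by linarith)
  have hge : 0 < Real.exp (-(t / θ)) := Real.exp_pos _
  have e2 : (2 * H - 2) = 2 * H - 1 - 1 := by ring
  unfold V2'
  rw [e2]
  simp only [C]
  set I := ∫ z in (0:ℝ)..t, Real.exp (z / θ) * z ^ (2 * H - 1 - 1)
  have key : Real.exp (t / θ) * (2 * H * (2 * H - 1) * Real.exp (-(2 * t) / θ) * I -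
      Real.exp (-(2 * t) / θ)) = Real.exp (-(t / θ)) * (2 * H * ((2 * H - 1) * I) - 1) := by
    rw [← he]; ring
  rw [key]
  set J := (2 * H - 1) * I
  set X := ε ^ (2 * H - 1)
  have hK : 0 ≤ Real.exp (ε / θ) / θ * ε ^ (2 * H - 1 + 1) := by positivity
  have hL : 0 ≤ ε ^ (2 * H - 1 - 1) * θ := by positivity
  set K := Real.exp (ε / θ) / θ * ε ^ (2 * H - 1 + 1)
  set L := ε ^ (2 * H - 1 - 1) * θ
  set E := Real.exp (-(t / θ))
  have hD : E * (J - X) ≤ (2 * H - 1) * (K + L) := by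
    have h1 : E * (J - X) ≤ E * ((2 * H - 1) * (K + L * Real.exp (t / θ))) := by
      gcongr; linarith
    have h2 : E * ((2 * H - 1) * (K + L * Real.exp (t / θ))) = (2 * H - 1) * (E * K + L) := by
      linear_combination (2 * H - 1) * L * hee
    rw [h2] at h1
    refine h1.trans ?_
    have : E * K ≤ K := mul_le_of_le_one_left hK hle
    have : 0 < 2 * H - 1 := by linarith
    gcongr
  calc |E * (2 * H * J - 1)| = |E * (2 * H * X - 1) + 2 * H * (E * (J - X))| := by
        congr 1; ring
    _ ≤ |E * (2 * H * X - 1)| + |2 * H * (E * (J - X))| := abs_add_le _ _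
    _ ≤ |2 * H * X - 1| + 2 * H * ((2 * H - 1) * (K + L)) := by
        apply add_le_add
        · rw [abs_mul, abs_of_pos hge]
          exact mul_le_of_le_one_left (abs_nonneg _) hle
        · have : 0 ≤ E * (J - X) := mul_nonneg hge.le (by linarith)
          rw [abs_of_nonneg (by apply mul_nonneg _ this; linarith)]
          gcongr
    _ = _ := by ring
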